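/- arXiv:2412.19728 — 2 statements merged into one kernel-verified Lean document; each statement's English description precedes it below -/
import Mathlib

section
/- Let P(X) = X(X+1) and let r be an integer. Then for every positive integer Q, Σ_{γ ∈ F_{Q,P}} e(rγ) = Σ_{d₁ ≤ Q} μ(d₁) · Σ_{d₂ ≤ Q} [μ(d₂)·d₂/(φ(d₂)·gcd(d₁,d₂))] · Σ q, where the innermost sum is over positive integers q ≤ Q·gcd(d₁,d₂)/(d₁d₂) such that (q·d₂/gcd(d₁,d₂)) | r, plus Σ_{q ≤ Q} Σ_{d | q} (μ(d)/φ(d)) · Σ_{χ mod d, χ ≠ χ₀} χ̄(−1) · Σ_{a ≤ q, gcd(a,q)=1} χ(a)·e(ar/q), the sum over χ being over non-principal Dirichlet characters modulo d. -/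
open Finset Filter

/-- The pairs `(a, q)` with `1 ≤ a ≤ q ≤ Q` and `gcd (P(a), q) = 1`, indexing the
polynomial Farey fractions `a / q` of order `Q`. -/
def fareyPairs (P : Polynomial ℤ) (Q : ℕ) : Finset (ℕ × ℕ) :=
  (Finset.Icc 1 Q ×ˢ Finset.Icc 1 Q).filter
    (fun x => x.1 ≤ x.2 ∧ Int.gcd (P.eval (x.1 : ℤ)) (x.2 : ℤ) = 1)

/-- The set of polynomial Farey fractions of order `Q`. -/
def fareySet (P : Polynomial ℤ) (Q : ℕ) : Finset ℚ :=
  (fareyPairs P Q).image (fun x => (x.1 : ℚ) / (x.2 : ℚ))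

/-- `f_P(m)` is the number of `1 ≤ d ≤ m` with `P(d) ≡ 0 (mod m)`. -/
def fP (P : Polynomial ℤ) (m : ℕ) : ℕ :=
  ((Finset.Icc 1 m).filter (fun d : ℕ => (m : ℤ) ∣ P.eval (d : ℤ))).card

/-- `β_P = ∏_p (1 - f_P(p)/p²)`, the product over all primes. -/
noncomputable def betaP (P : Polynomial ℤ) : ℝ :=
  ∏' p : Nat.Primes, (1 - (fP P (p : ℕ) : ℝ) / ((p : ℕ) : ℝ) ^ 2)

open scoped Classical in
/-- Pair correlation measure `S_F(Λ)` of a finite set `F ⊂ ℝ/ℤ` (represented by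
rationals): `(1/N) · #{(a,b) ∈ F² : a ≠ b, a - b ∈ (1/N)(0,Λ) + ℤ}`. -/
noncomputable def pairCorr (F : Finset ℚ) (Λ : ℝ) : ℝ :=
  (((F ×ˢ F).filter (fun x => x.1 ≠ x.2 ∧
      ∃ k : ℤ, ((x.1 : ℝ) - (x.2 : ℝ) - (k : ℝ)) * (F.card : ℝ) ∈ Set.Ioo 0 Λ)).card : ℝ) /
    (F.card : ℝ)

/-- `e(x) = exp(2πix)`. -/
noncomputable def eFun (x : ℝ) : ℂ := Complex.exp (2 * Real.pi * Complex.I * x)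

lemma aux_moebius (n : ℕ) (hn : n ≠ 0) :
    (∑ d ∈ n.divisors, (ArithmeticFunction.moebius d : ℂ)) = if n = 1 then 1 else 0 := by
  have h := congrArg (fun f => f n) ArithmeticFunction.moebius_mul_coe_zeta
  simp only [ArithmeticFunction.coe_mul_zeta_apply, ArithmeticFunction.one_apply] at h
  have h2 := congrArg (fun z : ℤ => (z : ℂ)) h
  push_cast at h2
  simpa using h2

lemma aux_moebius_gcd (m q : ℕ) (hq : q ≠ 0) :
    (if Nat.gcd m q = 1 then (1 : ℂ) else 0) =
      ∑ d ∈ q.divisors, if d ∣ m then (ArithmeticFunction.moebius d : ℂ) else 0 := by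
  rw [← aux_moebius _ (Nat.gcd_ne_zero_right hq), ← Finset.sum_filter]
  apply Finset.sum_congr _ (fun _ _ => rfl)
  ext d
  simp [Nat.dvd_gcd_iff, hq, and_comm]

lemma aux_geom (n : ℕ) (hn : n ≠ 0) (r : ℤ) :
    ∑ b ∈ Finset.Icc 1 n, eFun ((b : ℝ) * (r : ℝ) / (n : ℝ)) =
      if (n : ℤ) ∣ r then (n : ℂ) else 0 := by
  have hn' : (n : ℂ) ≠ 0 := by exact_mod_cast hn
  have hp := Complex.isPrimitiveRoot_exp n hn
  set z := Complex.exp (2 * Real.pi * Complex.I / n) with hz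
  have e : ∀ b : ℕ, eFun ((b : ℝ) * (r : ℝ) / (n : ℝ)) = (z ^ r) ^ b := by
    intro b
    rw [eFun, hz, ← Complex.exp_int_mul, ← Complex.exp_nat_mul]
    congr 1
    push_cast
    field_simp
  simp_rw [e]
  have hzn : (z ^ r) ^ n = 1 := by
    rw [← zpow_natCast, ← zpow_mul, mul_comm, zpow_mul, zpow_natCast, hp.pow_eq_one, one_zpow]
  split_ifs with h
  · rw [(hp.zpow_eq_one_iff_dvd r).2 h]
    simp
  · have h1 : z ^ r ≠ 1 := fun h' => h ((hp.zpow_eq_one_iff_dvd r).1 h')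
    have h2 : ∑ b ∈ Finset.Icc 1 n, (z ^ r) ^ b = z ^ r * ∑ b ∈ Finset.range n, (z ^ r) ^ b := by
      rw [Finset.mul_sum, ← Finset.Ico_add_one_right_eq_Icc, Finset.sum_Ico_eq_sum_range]
      apply Finset.sum_congr (by simp)
      intro i _
      ring
    rw [h2, geom_sum_eq h1, hzn]
    simp

lemma aux_ramanujan (q : ℕ) (hq : q ≠ 0) (r : ℤ) :
    ∑ a ∈ (Finset.Icc 1 q).filter (fun a : ℕ => Nat.gcd a q = 1),
        eFun ((a : ℝ) * (r : ℝ) / (q : ℝ)) =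
      ∑ d ∈ q.divisors, (ArithmeticFunction.moebius d : ℂ) *
        if ((q / d : ℕ) : ℤ) ∣ r then ((q / d : ℕ) : ℂ) else 0 := by
  have h1 : ∑ a ∈ (Finset.Icc 1 q).filter (fun a : ℕ => Nat.gcd a q = 1),
        eFun ((a : ℝ) * (r : ℝ) / (q : ℝ)) =
      ∑ a ∈ Finset.Icc 1 q, (∑ d ∈ q.divisors,
        if d ∣ a then (ArithmeticFunction.moebius d : ℂ) else 0) *
          eFun ((a : ℝ) * (r : ℝ) / (q : ℝ)) := by
    rw [Finset.sum_filter]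
    apply Finset.sum_congr rfl
    intro a _
    rw [← aux_moebius_gcd a q hq]
    split_ifs <;> simp
  rw [h1]
  simp_rw [Finset.sum_mul]
  rw [Finset.sum_comm]
  apply Finset.sum_congr rfl
  intro d hd
  have hdq := Nat.dvd_of_mem_divisors hd
  obtain ⟨n, rfl⟩ := hdq
  have hd0 : d ≠ 0 := by rintro rfl; simp at hq
  have hn0 : n ≠ 0 := by rintro rfl; simp at hq
  rw [Nat.mul_div_cancel_left n (Nat.pos_of_ne_zero hd0), ← aux_geom n hn0 r, Finset.mul_sum]
  simp_rw [ite_mul, zero_mul]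
  rw [← Finset.sum_filter]
  symm
  apply Finset.sum_bij (fun b _ => d * b)
  · intro b hb
    simp only [Finset.mem_Icc, Finset.mem_filter] at hb ⊢
    refine ⟨⟨?_, Nat.mul_le_mul_left d hb.2⟩, dvd_mul_right _ _⟩
    exact Nat.one_le_iff_ne_zero.2 (mul_ne_zero hd0 (by omega))
  · intro a _ b _ h
    exact Nat.eq_of_mul_eq_mul_left (Nat.pos_of_ne_zero hd0) h
  · intro a ha
    simp only [Finset.mem_Icc, Finset.mem_filter] at ha
    obtain ⟨⟨h1, h2⟩, b, rfl⟩ := ha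
    refine ⟨b, ?_, rfl⟩
    simp only [Finset.mem_Icc]
    refine ⟨?_, Nat.le_of_mul_le_mul_left h2 (Nat.pos_of_ne_zero hd0)⟩
    rcases Nat.eq_zero_or_pos b with rfl | h
    · simp at h1
    · exact h
  · intro b _
    congr 2
    push_cast
    have : (d : ℝ) ≠ 0 := by exact_mod_cast hd0
    rw [mul_assoc, mul_div_mul_left _ _ this]

lemma aux_char (d : ℕ) [NeZero d] (a : ℕ) :
    (if d ∣ a + 1 then (1 : ℂ) else 0) = (1 / (Nat.totient d : ℂ)) *
      ∑ χ : DirichletCharacter ℂ d, (starRingEnd ℂ) (χ (-1)) * χ (a : ZMod d) := by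
  have h := DirichletCharacter.sum_char_inv_mul_char_eq ℂ (n := d) (a := -1)
    isUnit_one.neg (a : ZMod d)
  have hc : ∀ χ : DirichletCharacter ℂ d, (starRingEnd ℂ) (χ (-1)) = χ (-1)⁻¹ := by
    intro χ
    rw [ZMod.inv_neg_one]
    have : χ (-1) * χ (-1) = 1 := by rw [← map_mul]; simp
    rcases mul_self_eq_one_iff.1 this with h | h <;> rw [h] <;> simp
  simp_rw [hc]
  rw [h]
  have ht : (Nat.totient d : ℂ) ≠ 0 := by
    exact_mod_cast (Nat.totient_pos.2 (NeZero.pos d)).ne'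
  have hiff : ((-1 : ZMod d) = (a : ZMod d)) ↔ d ∣ a + 1 := by
    rw [← ZMod.natCast_eq_zero_iff]
    push_cast
    constructor
    · intro h; rw [← h]; ring
    · intro h; linear_combination -h
  simp only [hiff]
  split_ifs
  · field_simp
  · simp

open scoped Classical in
lemma aux_char_sum (q d : ℕ) [NeZero d] (hdq : d ∣ q) (f : ℕ → ℂ) :
    ∑ a ∈ (Finset.Icc 1 q).filter (fun a : ℕ => Nat.gcd a q = 1),
        (if d ∣ a + 1 then f a else 0) =
      (1 / (Nat.totient d : ℂ)) *
        (∑ a ∈ (Finset.Icc 1 q).filter (fun a : ℕ => Nat.gcd a q = 1), f a) +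
      (1 / (Nat.totient d : ℂ)) * ∑ χ : DirichletCharacter ℂ d,
        (if χ = 1 then 0 else (starRingEnd ℂ) (χ (-1)) *
          ∑ a ∈ (Finset.Icc 1 q).filter (fun a : ℕ => Nat.gcd a q = 1),
            χ (a : ZMod d) * f a) := by
  have h1 : ∀ a, (if d ∣ a + 1 then f a else 0) = (1 / (Nat.totient d : ℂ)) *
      ∑ χ : DirichletCharacter ℂ d, (starRingEnd ℂ) (χ (-1)) * (χ (a : ZMod d) * f a) := by
    intro a
    have := aux_char d a
    calc _ = (if d ∣ a + 1 then (1 : ℂ) else 0) * f a := by split_ifs <;> simp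
      _ = _ := by
        rw [this, mul_assoc, Finset.sum_mul]
        simp_rw [mul_assoc]
  simp_rw [h1]
  rw [← Finset.mul_sum, Finset.sum_comm, ← mul_add]
  congr 1
  simp_rw [← Finset.mul_sum]
  rw [← Finset.add_sum_erase _ _ (Finset.mem_univ (1 : DirichletCharacter ℂ d)),
    ← Finset.add_sum_erase (a := (1 : DirichletCharacter ℂ d)) Finset.univ
      (fun χ : DirichletCharacter ℂ d => if χ = 1 then (0 : ℂ) else _) (Finset.mem_univ _)]
  rw [if_pos rfl, zero_add]
  congr 1
  · have : (1 : DirichletCharacter ℂ d) (-1) = 1 := MulChar.one_apply isUnit_one.neg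
    rw [this, map_one, one_mul]
    apply Finset.sum_congr rfl
    intro a ha
    have hu : IsUnit (a : ZMod d) := by
      rw [ZMod.isUnit_iff_coprime]
      exact Nat.Coprime.coprime_dvd_right hdq (Finset.mem_filter.1 ha).2
    rw [MulChar.one_apply hu, one_mul]
  · apply Finset.sum_congr rfl
    intro χ hχ
    rw [if_neg (Finset.ne_of_mem_erase hχ)]

lemma aux_divisors (Q q : ℕ) (hq : q ∈ Finset.Icc 1 Q) (F : ℕ → ℂ) :
    ∑ d ∈ q.divisors, F d = ∑ d ∈ Finset.Icc 1 Q, if d ∣ q then F d else 0 := by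
  rw [← Finset.sum_filter]
  apply Finset.sum_congr _ (fun _ _ => rfl)
  simp only [Finset.mem_Icc] at hq
  ext d
  simp only [Nat.mem_divisors, Finset.mem_filter, Finset.mem_Icc]
  constructor
  · rintro ⟨h, h0⟩
    exact ⟨⟨Nat.pos_of_dvd_of_pos h hq.1, (Nat.le_of_dvd hq.1 h).trans hq.2⟩, h⟩
  · rintro ⟨_, h⟩
    exact ⟨h, by omega⟩

lemma aux_inner (Q d₁ d₂ : ℕ) (h₁ : 0 < d₁) (h₂ : 0 < d₂) (r : ℤ) :
    ∑ q ∈ Finset.Icc 1 Q, (if d₂ ∣ q then if d₁ ∣ q then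
        (if ((q / d₁ : ℕ) : ℤ) ∣ r then ((q / d₁ : ℕ) : ℂ) else 0) else 0 else 0) =
      ((d₂ : ℂ) / (Nat.gcd d₁ d₂ : ℂ)) * ∑ q ∈ (Finset.Icc 1 Q).filter (fun q : ℕ =>
          q * d₁ * d₂ ≤ Q * Nat.gcd d₁ d₂ ∧
            ((q * d₂ / Nat.gcd d₁ d₂ : ℕ) : ℤ) ∣ r), (q : ℂ) := by
  have hg : 0 < Nat.gcd d₁ d₂ := Nat.gcd_pos_of_pos_left _ h₁
  obtain ⟨g, x, y, hg', hxy, hx, hy⟩ : ∃ g x y, Nat.gcd d₁ d₂ = g ∧ Nat.Coprime x y ∧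
      d₁ = x * g ∧ d₂ = y * g := by
    obtain ⟨x, y, h, hx, hy⟩ := Nat.exists_coprime d₁ d₂
    exact ⟨_, x, y, rfl, h, hx, hy⟩
  rw [hg'] at hg ⊢
  subst hx hy
  have hx : 0 < x := Nat.pos_of_mul_pos_right h₁
  have hy : 0 < y := Nat.pos_of_mul_pos_right h₂
  have hgC : (g : ℂ) ≠ 0 := by exact_mod_cast hg.ne'
  have e1 : ∀ k, k * (y * g) / g = k * y := fun k => by
    rw [← mul_assoc, Nat.mul_div_cancel _ hg]
  have e2 : ∀ k, k * (x * y * g) / (x * g) = k * y := fun k => by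
    rw [show k * (x * y * g) = k * y * (x * g) by ring, Nat.mul_div_cancel _ h₁]
  have e3 : ∀ k, k * (x * g) * (y * g) ≤ Q * g ↔ k * (x * y * g) ≤ Q := fun k => by
    rw [show k * (x * g) * (y * g) = k * (x * y * g) * g by ring]
    exact Nat.mul_le_mul_right_iff hg
  have hL : 0 < x * y * g := by positivity
  simp_rw [e1, e3]
  rw [Finset.mul_sum]
  simp_rw [← ite_and]
  rw [← Finset.sum_filter]
  symm
  apply Finset.sum_bij (fun k _ => k * (x * y * g))
  · intro k hk
    simp only [Finset.mem_filter, Finset.mem_Icc] at hk ⊢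
    refine ⟨⟨Nat.mul_pos hk.1.1 hL, hk.2.1⟩, ⟨k * x, by ring⟩, ⟨k * y, by ring⟩, ?_⟩
    rw [e2]; exact hk.2.2
  · intro a _ b _ h
    exact Nat.eq_of_mul_eq_mul_right hL h
  · intro q hq
    simp only [Finset.mem_filter, Finset.mem_Icc] at hq
    obtain ⟨⟨hq1, hq2⟩, ha, hb, hc⟩ := hq
    have hdv : x * y * g ∣ q := by
      obtain ⟨m, rfl⟩ := hb
      have : y ∣ x * m := by
        have : g * y ∣ g * (x * m) := by
          rw [show g * y = y * g by ring, show g * (x * m) = x * g * m by ring]; exact ha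
        exact Nat.dvd_of_mul_dvd_mul_left hg this
      obtain ⟨t, rfl⟩ := hxy.symm.dvd_of_dvd_mul_left this
      exact ⟨t, by ring⟩
    obtain ⟨k, rfl⟩ := hdv
    rw [mul_comm, e2] at hc
    have hk : 0 < k := Nat.pos_of_mul_pos_left hq1
    refine ⟨k, ?_, mul_comm _ _⟩
    simp only [Finset.mem_filter, Finset.mem_Icc]
    refine ⟨⟨hk, (Nat.le_mul_of_pos_left k hL).trans hq2⟩, by rwa [mul_comm], hc⟩
  · intro k _
    rw [e2]
    push_cast
    field_simp

lemma aux_main (Q : ℕ) (r : ℤ) :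
    ∑ q ∈ Finset.Icc 1 Q, ∑ d ∈ q.divisors,
      ((ArithmeticFunction.moebius d : ℂ) / (Nat.totient d : ℂ)) *
        ∑ a ∈ (Finset.Icc 1 q).filter (fun a : ℕ => Nat.gcd a q = 1),
          eFun ((a : ℝ) * (r : ℝ) / (q : ℝ)) =
      (∑ d₁ ∈ Finset.Icc 1 Q, (ArithmeticFunction.moebius d₁ : ℂ) *
        ∑ d₂ ∈ Finset.Icc 1 Q,
          ((ArithmeticFunction.moebius d₂ : ℂ) * (d₂ : ℂ) /
              ((Nat.totient d₂ : ℂ) * (Nat.gcd d₁ d₂ : ℂ))) *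
            ∑ q ∈ (Finset.Icc 1 Q).filter (fun q : ℕ =>
                q * d₁ * d₂ ≤ Q * Nat.gcd d₁ d₂ ∧
                  ((q * d₂ / Nat.gcd d₁ d₂ : ℕ) : ℤ) ∣ r),
              (q : ℂ)) := by
  have h1 : ∀ q ∈ Finset.Icc 1 Q, (∑ d ∈ q.divisors,
      ((ArithmeticFunction.moebius d : ℂ) / (Nat.totient d : ℂ)) *
        ∑ a ∈ (Finset.Icc 1 q).filter (fun a : ℕ => Nat.gcd a q = 1),
          eFun ((a : ℝ) * (r : ℝ) / (q : ℝ))) =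
      ∑ d₁ ∈ Finset.Icc 1 Q, ∑ d₂ ∈ Finset.Icc 1 Q,
        (ArithmeticFunction.moebius d₁ : ℂ) *
        (((ArithmeticFunction.moebius d₂ : ℂ) / (Nat.totient d₂ : ℂ)) *
        (if d₂ ∣ q then if d₁ ∣ q then
        (if ((q / d₁ : ℕ) : ℤ) ∣ r then ((q / d₁ : ℕ) : ℂ) else 0) else 0 else 0)) := by
    intro q hq
    have hq0 : q ≠ 0 := by simp only [Finset.mem_Icc] at hq; omega
    rw [aux_ramanujan q hq0 r, aux_divisors Q q hq, aux_divisors Q q hq, Finset.sum_comm]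
    apply Finset.sum_congr rfl
    intro d₂ _
    split_ifs
    · rw [Finset.mul_sum]
      apply Finset.sum_congr rfl
      intro d₁ _
      split_ifs <;> ring
    · simp
  rw [Finset.sum_congr rfl h1, Finset.sum_comm]
  apply Finset.sum_congr rfl
  intro d₁ hd₁
  rw [Finset.sum_comm, Finset.mul_sum]
  apply Finset.sum_congr rfl
  intro d₂ hd₂
  simp only [Finset.mem_Icc] at hd₁ hd₂
  rw [← Finset.mul_sum, ← Finset.mul_sum, aux_inner Q d₁ d₂ hd₁.1 hd₂.1 r, mul_div_mul_comm]
  ring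

lemma aux_split (P : Polynomial ℤ) (hP : P = Polynomial.X * (Polynomial.X + 1))
    (Q : ℕ) (f : ℕ → ℕ → ℂ) :
    ∑ x ∈ fareyPairs P Q, f x.1 x.2 =
      ∑ q ∈ Finset.Icc 1 Q, ∑ d ∈ q.divisors, (ArithmeticFunction.moebius d : ℂ) *
        ∑ a ∈ (Finset.Icc 1 q).filter (fun a : ℕ => Nat.gcd a q = 1),
          (if d ∣ a + 1 then f a q else 0) := by
  rw [fareyPairs, Finset.sum_filter, Finset.sum_product_right]
  apply Finset.sum_congr rfl
  intro q hq
  simp only [Finset.mem_Icc] at hq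
  have hq0 : q ≠ 0 := by omega
  simp_rw [Finset.mul_sum]
  rw [Finset.sum_comm]
  have h1 : ∀ a : ℕ, (∑ d ∈ q.divisors, (ArithmeticFunction.moebius d : ℂ) *
      (if d ∣ a + 1 then f a q else 0)) = if Nat.gcd (a + 1) q = 1 then f a q else 0 := by
    intro a
    have := aux_moebius_gcd (a + 1) q hq0
    calc _ = (∑ d ∈ q.divisors, if d ∣ a + 1 then (ArithmeticFunction.moebius d : ℂ) else 0)
          * f a q := by
          rw [Finset.sum_mul]
          apply Finset.sum_congr rfl
          intro d _
          split_ifs <;> simp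
      _ = _ := by rw [← this]; split_ifs <;> simp
  simp_rw [h1]
  rw [← Finset.sum_filter, ← Finset.sum_filter, Finset.filter_filter]
  apply Finset.sum_congr _ (fun _ _ => rfl)
  ext a
  have h2 : Int.gcd (P.eval (a : ℤ)) (q : ℤ) = Nat.gcd (a * (a + 1)) q := by
    rw [hP]
    simp only [Polynomial.eval_mul, Polynomial.eval_add, Polynomial.eval_X, Polynomial.eval_one]
    rw [← Int.gcd_natCast_natCast]
    push_cast
    rfl
  simp only [Finset.mem_filter, Finset.mem_Icc, h2]
  have h3 : Nat.gcd (a * (a + 1)) q = 1 ↔ Nat.gcd a q = 1 ∧ Nat.gcd (a + 1) q = 1 :=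
    Nat.coprime_mul_iff_left
  rw [h3]
  constructor
  · rintro ⟨h, h', h''⟩
    exact ⟨⟨h.1, h'⟩, h''⟩
  · rintro ⟨h, h''⟩
    exact ⟨⟨h.1, h.2.trans hq.2⟩, h.2, h''⟩

open scoped Classical in
/-- **Lemma (exponential sum for `P(X) = X(X+1)`).** The Weyl sum
`Σ_{γ ∈ F_{Q,P}} e(rγ)` equals the principal-character main term
`Σ_{d₁ ≤ Q} μ(d₁) Σ_{d₂ ≤ Q} (μ(d₂)d₂/(φ(d₂)·gcd(d₁,d₂))) Σ_{q ≤ Q·gcd(d₁,d₂)/(d₁d₂),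
(q·d₂/gcd(d₁,d₂)) ∣ r} q` plus the non-principal character contribution
`Σ_{q ≤ Q} Σ_{d ∣ q} (μ(d)/φ(d)) Σ_{χ mod d, χ ≠ χ₀} χ̄(-1) Σ_{a ≤ q, (a,q)=1} χ(a) e(ar/q)`. -/
theorem expSum_Pxx (P : Polynomial ℤ) (hP : P = Polynomial.X * (Polynomial.X + 1))
    (r : ℤ) (Q : ℕ) (hQ : 1 ≤ Q) :
    ∑ x ∈ fareyPairs P Q, eFun ((r : ℝ) * (x.1 : ℝ) / (x.2 : ℝ)) =
      (∑ d₁ ∈ Finset.Icc 1 Q, (ArithmeticFunction.moebius d₁ : ℂ) *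
        ∑ d₂ ∈ Finset.Icc 1 Q,
          ((ArithmeticFunction.moebius d₂ : ℂ) * (d₂ : ℂ) /
              ((Nat.totient d₂ : ℂ) * (Nat.gcd d₁ d₂ : ℂ))) *
            ∑ q ∈ (Finset.Icc 1 Q).filter (fun q : ℕ =>
                q * d₁ * d₂ ≤ Q * Nat.gcd d₁ d₂ ∧
                  ((q * d₂ / Nat.gcd d₁ d₂ : ℕ) : ℤ) ∣ r),
              (q : ℂ)) +
      ∑ q ∈ Finset.Icc 1 Q, ∑ d ∈ q.divisors.attach,
        haveI : NeZero d.1 := ⟨(Nat.pos_of_mem_divisors d.2).ne'⟩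
        ((ArithmeticFunction.moebius d.1 : ℂ) / (Nat.totient d.1 : ℂ)) *
          ∑ χ : DirichletCharacter ℂ d.1,
            (if χ = 1 then 0 else
              (starRingEnd ℂ) (χ (-1)) *
                ∑ a ∈ (Finset.Icc 1 q).filter (fun a : ℕ => Nat.gcd a q = 1),
                  χ (a : ZMod d.1) * eFun ((a : ℝ) * (r : ℝ) / (q : ℝ))) := by
  have h0 : ∀ x : ℕ × ℕ, eFun ((r : ℝ) * (x.1 : ℝ) / (x.2 : ℝ)) =
      (fun a q : ℕ => eFun ((a : ℝ) * (r : ℝ) / (q : ℝ))) x.1 x.2 := by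
    intro x
    simp only [mul_comm]
  rw [Finset.sum_congr rfl (fun x _ => h0 x), aux_split P hP Q (fun a q : ℕ => eFun ((a : ℝ) * (r : ℝ) / (q : ℝ))),
    ← aux_main Q r,
    ← Finset.sum_add_distrib]
  apply Finset.sum_congr rfl
  intro q _
  rw [← Finset.sum_attach, ← Finset.sum_attach q.divisors (fun d =>
    ((ArithmeticFunction.moebius d : ℂ) / (Nat.totient d : ℂ)) * _), ← Finset.sum_add_distrib]
  apply Finset.sum_congr rfl
  intro d _
  haveI : NeZero d.1 := ⟨(Nat.pos_of_mem_divisors d.2).ne'⟩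
  rw [aux_char_sum q d.1 (Nat.dvd_of_mem_divisors d.2)
    (fun a => eFun ((a : ℝ) * (r : ℝ) / (q : ℝ)))]
  ring
end

section
/- Let ν ≥ 1 and let P(X) = c_ν X^ν + ⋯ + c_1 X ∈ ℤ[X] be a polynomial with nonzero discriminant. Then for every ε > 0, the cardinality N_{Q,P} = #F_{Q,P} satisfies N_{Q,P} = (Q²/2)·∏_p (1 − f_P(p)/p²) + O(Q^{1+ε}) as Q → ∞, the product being over all primes p and the implied constant depending on P and ε. -/
open Finset Filter

theorem dvd_iff_aeval (P : Polynomial ℤ) (m a : ℕ) :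
    ((m : ℤ) ∣ P.eval (a : ℤ)) ↔ Polynomial.aeval (a : ZMod m) P = 0 := by
  rw [← ZMod.intCast_zmod_eq_zero_iff_dvd]
  have : Polynomial.aeval (a : ZMod m) P = ((P.eval (a : ℤ) : ℤ) : ZMod m) := by
    have := Polynomial.aeval_algebraMap_apply (ZMod m) (a : ℤ) P
    simpa using this
  rw [this]

theorem periodic_dvd (P : Polynomial ℤ) (m : ℕ) :
    Function.Periodic (fun d : ℕ => (m : ℤ) ∣ P.eval (d : ℤ)) m := by
  intro x
  simp only [dvd_iff_aeval]
  simp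

theorem Icc_one_eq (m : ℕ) : Finset.Icc 1 m = Finset.Ico 1 (1 + m) := by
  ext x; simp; omega

theorem fP_eq_count (P : Polynomial ℤ) (m : ℕ) :
    fP P m = m.count (fun d : ℕ => (m : ℤ) ∣ P.eval (d : ℤ)) := by
  unfold fP
  rw [Icc_one_eq]
  exact Nat.filter_Ico_card_eq_of_periodic 1 m _ (periodic_dvd P m)

theorem card_mul (P : Polynomial ℤ) (d k : ℕ) :
    ((Finset.Icc 1 (d * k)).filter (fun a : ℕ => (d : ℤ) ∣ P.eval (a : ℤ))).card
      = k * fP P d := by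
  induction k with
  | zero => simp
  | succ k ih =>
    rw [Icc_one_eq] at ih ⊢
    rw [← Finset.Ico_union_Ico_eq_Ico (a := 1) (b := 1 + d * k) (by omega)
      (by rw [Nat.mul_succ]; omega), Finset.filter_union, Finset.card_union_of_disjoint, ih]
    · have := Nat.filter_Ico_card_eq_of_periodic (1 + d * k) d _ (periodic_dvd P d)
      rw [Nat.mul_succ, ← add_assoc, this, ← fP_eq_count]
      ring
    · exact Finset.disjoint_filter_filter (Finset.Ico_disjoint_Ico_consecutive _ _ _)

theorem fP_zmod (P : Polynomial ℤ) (m : ℕ) [NeZero m] :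
    fP P m = Nat.card {x : ZMod m // Polynomial.aeval x P = 0} := by
  classical
  rw [fP_eq_count, Nat.count_eq_card_filter_range, Nat.card_eq_fintype_card, Fintype.card_subtype]
  apply Finset.card_bij (fun (a : ℕ) _ => (a : ZMod m))
  · intro a ha
    simp only [Finset.mem_filter, dvd_iff_aeval] at ha
    simp [ha.2]
  · intro a ha b hb h
    simp only [Finset.mem_filter, Finset.mem_range] at ha hb
    have := (ZMod.natCast_eq_natCast_iff' a b m).1 h
    rwa [Nat.mod_eq_of_lt ha.1, Nat.mod_eq_of_lt hb.1] at this
  · intro b hb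
    refine ⟨b.val, ?_, by simp⟩
    simp only [Finset.mem_filter, Finset.mem_range, dvd_iff_aeval, Finset.mem_univ, true_and] at hb ⊢
    exact ⟨ZMod.val_lt b, by simpa using hb⟩

theorem fP_mul (P : Polynomial ℤ) {m n : ℕ} (h : m.Coprime n) :
    fP P (m * n) = fP P m * fP P n := by
  rcases Nat.eq_zero_or_pos m with rfl | hm
  · simp [fP]
  rcases Nat.eq_zero_or_pos n with rfl | hn
  · simp [fP]
  have : NeZero m := ⟨hm.ne'⟩
  have : NeZero n := ⟨hn.ne'⟩
  rw [fP_zmod, fP_zmod, fP_zmod, ← Nat.card_prod]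
  let e := ZMod.chineseRemainder h
  have key : ∀ x : ZMod (m * n), Polynomial.aeval x P = 0 ↔
      Polynomial.aeval (e x).1 P = 0 ∧ Polynomial.aeval (e x).2 P = 0 := by
    intro x
    have h1 : Polynomial.aeval (e x).1 P = (e (Polynomial.aeval x P)).1 := by
      have := Polynomial.map_aeval_eq_aeval_map (φ := RingHom.id ℤ)
        (ψ := (RingHom.fst (ZMod m) (ZMod n)).comp e.toRingHom) (RingHom.ext_int _ _) P x
      simpa using this.symm
    have h2 : Polynomial.aeval (e x).2 P = (e (Polynomial.aeval x P)).2 := by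
      have := Polynomial.map_aeval_eq_aeval_map (φ := RingHom.id ℤ)
        (ψ := (RingHom.snd (ZMod m) (ZMod n)).comp e.toRingHom) (RingHom.ext_int _ _) P x
      simpa using this.symm
    rw [h1, h2, ← e.map_eq_zero_iff, Prod.ext_iff]
    rfl
  exact Nat.card_congr ((e.toEquiv.subtypeEquiv key).trans (Equiv.subtypeProdEquivProd
    (p := fun x : ZMod m => Polynomial.aeval x P = 0)
    (q := fun x : ZMod n => Polynomial.aeval x P = 0)))

theorem fP_le_self (P : Polynomial ℤ) (m : ℕ) : fP P m ≤ m := by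
  unfold fP
  exact (Finset.card_filter_le _ _).trans (by simp)

theorem fP_one (P : Polynomial ℤ) : fP P 1 = 1 := by simp [fP]

theorem fP_prime_le (P : Polynomial ℤ) (hP : P ≠ 0) :
    ∃ M : ℕ, 1 ≤ M ∧ ∀ p : ℕ, p.Prime → fP P p ≤ M := by
  classical
  refine ⟨P.natDegree + P.leadingCoeff.natAbs + 1, by omega, fun p hp => ?_⟩
  have := Fact.mk hp
  by_cases h0 : P.map (Int.castRingHom (ZMod p)) = 0
  · have h1 : ((P.leadingCoeff : ℤ) : ZMod p) = 0 := by
      have := congrArg (fun R => Polynomial.coeff R P.natDegree) h0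
      simpa using this
    rw [ZMod.intCast_zmod_eq_zero_iff_dvd] at h1
    have h2 := Nat.le_of_dvd (by simpa [Int.natAbs_pos] using hP) (Int.natCast_dvd.1 h1)
    have := fP_le_self P p
    omega
  · rw [fP_zmod, Nat.card_eq_fintype_card, Fintype.card_subtype]
    have h1 : Finset.univ.filter (fun x : ZMod p => Polynomial.aeval x P = 0) ⊆
        (P.map (Int.castRingHom (ZMod p))).roots.toFinset := by
      intro x hx
      simp only [Finset.mem_filter, Finset.mem_univ, true_and] at hx
      simp only [Multiset.mem_toFinset, Polynomial.mem_roots h0, Polynomial.IsRoot.def,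
        Polynomial.eval_map]
      simpa [Polynomial.aeval_def] using hx
    have h2 := (Finset.card_le_card h1).trans (Multiset.toFinset_card_le _)
    have h3 := Polynomial.card_roots' (P.map (Int.castRingHom (ZMod p)))
    have h4 : (P.map (Int.castRingHom (ZMod p))).natDegree ≤ P.natDegree :=
      Polynomial.natDegree_map_le
    omega

theorem fP_bound (P : Polynomial ℤ) (hP : P ≠ 0) (δ : ℝ) (hδ : 0 < δ) :
    ∃ C : ℝ, 0 < C ∧ ∀ d : ℕ, Squarefree d → (fP P d : ℝ) ≤ C * (d : ℝ) ^ δ := by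
  obtain ⟨M, hM, hp⟩ := fP_prime_le P hP
  have hM' : (1 : ℝ) ≤ M := by exact_mod_cast hM
  obtain ⟨B, hB⟩ := exists_nat_ge ((M : ℝ) ^ (1 / δ))
  refine ⟨(M : ℝ) ^ B, by positivity, fun d hd => ?_⟩
  let F : ArithmeticFunction ℝ := ⟨fun n => (fP P n : ℝ), by simp [fP]⟩
  have hF : F.IsMultiplicative := by
    refine ⟨by simp [F, fP_one], fun {m n} h => ?_⟩
    simp [F, fP_mul P h]
  have h1 : (fP P d : ℝ) = ∏ p ∈ d.primeFactors, (fP P p : ℝ) := by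
    have := hF.map_prod_of_subset_primeFactors d d.primeFactors subset_rfl
    rw [Nat.prod_primeFactors_of_squarefree hd] at this
    simpa [F] using this
  have h2 : (d : ℝ) ^ δ = ∏ p ∈ d.primeFactors, (p : ℝ) ^ δ := by
    conv_lhs => rw [← Nat.prod_primeFactors_of_squarefree hd]
    push_cast
    rw [Real.finsetProd_rpow]
    intro i _; positivity
  have h3 : ∏ p ∈ d.primeFactors, (if p < B then (M : ℝ) else 1) ≤ (M : ℝ) ^ B := by
    rw [Finset.prod_ite]
    simp only [Finset.prod_const, one_pow, mul_one]
    apply pow_le_pow_right₀ hM'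
    calc _ ≤ (Finset.range B).card := Finset.card_le_card (by intro x; simp)
      _ = B := by simp
  calc (fP P d : ℝ) = ∏ p ∈ d.primeFactors, (fP P p : ℝ) := h1
    _ ≤ ∏ p ∈ d.primeFactors, ((if p < B then (M : ℝ) else 1) * (p : ℝ) ^ δ) := by
      apply Finset.prod_le_prod
      · intro i _; positivity
      · intro p hpp
        have pp := Nat.prime_of_mem_primeFactors hpp
        have h5 : (fP P p : ℝ) ≤ M := by exact_mod_cast hp p pp
        have h6 : (1 : ℝ) ≤ p := by exact_mod_cast pp.one_le
        split_ifs with hlt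
        · have := Real.one_le_rpow h6 hδ.le
          nlinarith
        · push Not at hlt
          rw [one_mul]
          have h7 : (M : ℝ) ^ (1 / δ) ≤ p := hB.trans (by exact_mod_cast hlt)
          have h8 := Real.rpow_le_rpow (by positivity) h7 hδ.le
          rw [← Real.rpow_mul (by positivity), one_div_mul_cancel hδ.ne', Real.rpow_one] at h8
          exact h5.trans h8
    _ = (∏ p ∈ d.primeFactors, (if p < B then (M : ℝ) else 1)) * (d : ℝ) ^ δ := by
      rw [Finset.prod_mul_distrib, h2]
    _ ≤ _ := by gcongr

theorem moebius_gcd (z : ℤ) (q : ℕ) (hq : 0 < q) :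
    (if Int.gcd z (q : ℤ) = 1 then (1 : ℝ) else 0) =
      ∑ d ∈ q.divisors, if (d : ℤ) ∣ z then (ArithmeticFunction.moebius d : ℝ) else 0 := by
  rw [← Finset.sum_filter]
  have h1 : q.divisors.filter (fun d : ℕ => (d : ℤ) ∣ z) = (Int.gcd z (q : ℤ)).divisors := by
    ext d
    have : Int.gcd z (q : ℤ) ≠ 0 := by
      rw [Ne, Int.gcd_eq_zero_iff]; omega
    simp only [Finset.mem_filter, Nat.mem_divisors, ne_eq, this, not_false_eq_true, and_true,
      Int.dvd_gcd_iff, Int.natCast_dvd_natCast, hq.ne']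
    rw [← Int.natCast_dvd_natCast]
    tauto
  rw [h1]
  have h2 := congrArg (fun F : ArithmeticFunction ℤ => F (Int.gcd z (q : ℤ)))
    ArithmeticFunction.moebius_mul_coe_zeta
  simp only [ArithmeticFunction.coe_mul_zeta_apply, ArithmeticFunction.one_apply] at h2
  have h3 := congrArg (fun x : ℤ => (x : ℝ)) h2
  push_cast at h3
  exact h3.symm

theorem sum_quot (Q d : ℕ) (hd : 0 < d) :
    ∑ q ∈ Finset.Icc 1 Q, (if d ∣ q then ((q / d : ℕ) : ℝ) else 0) =
      ((Q / d : ℕ) : ℝ) * (((Q / d : ℕ) : ℝ) + 1) / 2 := by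
  have h1 : ∀ n : ℕ, ∑ m ∈ Finset.Icc 1 n, (m : ℝ) = (n : ℝ) * (n + 1) / 2 := by
    intro n
    induction n with
    | zero => simp
    | succ n ih =>
      rw [Finset.sum_Icc_succ_top (by omega), ih]; push_cast; ring
  rw [← h1, ← Finset.sum_filter]
  refine Finset.sum_nbij' (fun q => q / d) (fun m => m * d) ?_ ?_ ?_ ?_ ?_
  · intro q hq
    simp only [Finset.mem_filter, Finset.mem_Icc] at hq ⊢
    exact ⟨Nat.div_pos (Nat.le_of_dvd (by omega) hq.2) hd, Nat.div_le_div_right hq.1.2⟩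
  · intro m hm
    simp only [Finset.mem_filter, Finset.mem_Icc] at hm ⊢
    refine ⟨⟨Nat.mul_pos hm.1 hd, (Nat.le_div_iff_mul_le hd).1 hm.2⟩, Dvd.intro_left m rfl⟩
  · intro q hq
    simp only [Finset.mem_filter] at hq
    exact Nat.div_mul_cancel hq.2
  · intro m _
    exact Nat.mul_div_cancel _ hd
  · intro q _; rfl

theorem card_fareyPairs (P : Polynomial ℤ) (Q : ℕ) :
    ((fareyPairs P Q).card : ℝ) = ∑ d ∈ Finset.Icc 1 Q,
      ((ArithmeticFunction.moebius d : ℝ) * fP P d) *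
        (((Q / d : ℕ) : ℝ) * (((Q / d : ℕ) : ℝ) + 1) / 2) := by
  have h1 : ((fareyPairs P Q).card : ℝ) = ∑ q ∈ Finset.Icc 1 Q, ∑ a ∈ Finset.Icc 1 q,
      (if Int.gcd (P.eval (a : ℤ)) (q : ℤ) = 1 then (1 : ℝ) else 0) := by
    unfold fareyPairs
    rw [Finset.card_filter, Finset.sum_product_right]
    push_cast
    apply Finset.sum_congr rfl
    intro q hq
    rw [Finset.mem_Icc] at hq
    have : Finset.Icc 1 q = (Finset.Icc 1 Q).filter (fun a => a ≤ q) := by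
      ext a; simp; omega
    rw [this, Finset.sum_filter]
    apply Finset.sum_congr rfl
    intro a _
    by_cases h : a ≤ q <;> simp [h]
  rw [h1]
  have h2 : ∀ q ∈ Finset.Icc 1 Q, ∑ a ∈ Finset.Icc 1 q,
      (if Int.gcd (P.eval (a : ℤ)) (q : ℤ) = 1 then (1 : ℝ) else 0) =
      ∑ d ∈ Finset.Icc 1 Q, ((ArithmeticFunction.moebius d : ℝ) * fP P d) *
        (if d ∣ q then ((q / d : ℕ) : ℝ) else 0) := by
    intro q hq
    rw [Finset.mem_Icc] at hq
    rw [Finset.sum_congr rfl (fun (a : ℕ) _ => moebius_gcd (P.eval (a : ℤ)) q hq.1), Finset.sum_comm]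
    have h3 : q.divisors = (Finset.Icc 1 Q).filter (fun d => d ∣ q) := by
      ext d
      simp only [Nat.mem_divisors, Finset.mem_filter, Finset.mem_Icc]
      constructor
      · rintro ⟨h, h'⟩
        exact ⟨⟨Nat.pos_of_dvd_of_pos h hq.1, (Nat.le_of_dvd hq.1 h).trans hq.2⟩, h⟩
      · rintro ⟨_, h⟩; exact ⟨h, by omega⟩
    rw [h3, Finset.sum_filter]
    apply Finset.sum_congr rfl
    intro d hd
    split_ifs with hdq
    · obtain ⟨k, rfl⟩ := hdq
      rw [Finset.mem_Icc] at hd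
      rw [← Finset.sum_filter, Finset.sum_const, card_mul, Nat.mul_div_cancel_left _ hd.1]
      simp; ring
    · simp
  rw [Finset.sum_congr rfl h2, Finset.sum_comm]
  apply Finset.sum_congr rfl
  intro d hd
  rw [Finset.mem_Icc] at hd
  rw [← Finset.mul_sum, sum_quot Q d hd.1]

theorem T_bound (Q d : ℕ) (hQ : 1 ≤ Q) (hd : 1 ≤ d) (η : ℝ) (h0 : 0 ≤ η) (h1 : η ≤ 1) :
    |((Q / d : ℕ) : ℝ) * (((Q / d : ℕ) : ℝ) + 1) / 2 - ((Q : ℝ) / d) ^ 2 / 2| ≤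
      ((Q : ℝ) / d) ^ (1 + η) := by
  have hQ' : (1 : ℝ) ≤ Q := by exact_mod_cast hQ
  have hd' : (1 : ℝ) ≤ d := by exact_mod_cast hd
  have hx : 0 < (Q : ℝ) / d := by positivity
  rcases le_or_gt d Q with h | h
  · have h3 : 1 ≤ (Q : ℝ) / d := by
      rw [le_div_iff₀ (by linarith)]; rw [one_mul]; exact_mod_cast h
    have h4 : ((Q / d : ℕ) : ℝ) ≤ (Q : ℝ) / d := Nat.cast_div_le
    have h5 : (Q : ℝ) / d < ((Q / d : ℕ) : ℝ) + 1 := by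
      rw [div_lt_iff₀ (by linarith)]
      exact_mod_cast Nat.lt_mul_of_div_lt (Nat.lt_succ_self (Q / d)) (by omega)
    have h6 : (Q : ℝ) / d ≤ ((Q : ℝ) / d) ^ (1 + η) := by
      conv_lhs => rw [← Real.rpow_one ((Q : ℝ) / d)]
      exact Real.rpow_le_rpow_of_exponent_le h3 (by linarith)
    refine le_trans ?_ h6
    generalize (Q : ℝ) / d = x at *
    have h7 : (0 : ℝ) ≤ ((Q / d : ℕ) : ℝ) := by positivity
    generalize ((Q / d : ℕ) : ℝ) = n at *
    rw [abs_le]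
    constructor <;> nlinarith
  · have h3 : (Q : ℝ) / d ≤ 1 := by
      rw [div_le_one (by linarith)]; exact_mod_cast h.le
    rw [Nat.div_eq_of_lt h]
    have h6 : ((Q : ℝ) / d) ^ 2 ≤ ((Q : ℝ) / d) ^ (1 + η) := by
      rw [← Real.rpow_natCast]
      exact Real.rpow_le_rpow_of_exponent_ge hx h3 (by push_cast; linarith)
    have h8 : 0 ≤ ((Q : ℝ) / d) ^ 2 := by positivity
    rw [abs_le]
    constructor <;> simp <;> linarith

theorem g_bound (P : Polynomial ℤ) (hP : P ≠ 0) (δ : ℝ) (hδ : 0 < δ) :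
    ∃ C : ℝ, 0 < C ∧ ∀ d : ℕ,
      |(ArithmeticFunction.moebius d : ℝ) * fP P d| ≤ C * (d : ℝ) ^ δ := by
  obtain ⟨C, hC, h⟩ := fP_bound P hP δ hδ
  refine ⟨C, hC, fun d => ?_⟩
  by_cases hd : Squarefree d
  · rw [abs_mul, Nat.abs_cast]
    have h1 : |(ArithmeticFunction.moebius d : ℝ)| ≤ 1 := by
      exact_mod_cast ArithmeticFunction.abs_moebius_le_one
    calc _ ≤ 1 * (fP P d : ℝ) := by gcongr
      _ ≤ _ := by rw [one_mul]; exact h d hd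
  · rw [ArithmeticFunction.moebius_eq_zero_of_not_squarefree hd]
    simp; positivity

theorem betaP_hasSum (P : Polynomial ℤ) (hP : P ≠ 0) :
    HasSum (fun d : ℕ => ((ArithmeticFunction.moebius d : ℝ) * fP P d) / (d : ℝ) ^ 2)
      (betaP P) := by
  set F : ℕ → ℝ := fun d : ℕ => ((ArithmeticFunction.moebius d : ℝ) * fP P d) / (d : ℝ) ^ 2
    with hF
  have hs : Summable (fun d => ‖F d‖) := by
    obtain ⟨C, hC, h⟩ := g_bound P hP (1 / 2) (by norm_num)
    have h1 : Summable (fun d : ℕ => C * (d : ℝ) ^ (-(3 / 2) : ℝ)) :=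
      (Real.summable_nat_rpow.2 (by norm_num)).mul_left C
    refine Summable.of_nonneg_of_le (fun d => norm_nonneg _) (fun d => ?_) h1
    rcases Nat.eq_zero_or_pos d with rfl | hd
    · simp [hF]
      try positivity
    have hd' : (0 : ℝ) < d := by exact_mod_cast hd
    rw [Real.norm_eq_abs, hF]
    simp only [abs_div, abs_pow, Nat.abs_cast]
    rw [div_le_iff₀ (by positivity), mul_assoc, ← Real.rpow_natCast, ← Real.rpow_add hd']
    have h9 : (-(3 / 2) : ℝ) + ((2 : ℕ) : ℝ) = 1 / 2 := by norm_num
    rw [h9]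
    exact h d
  have hp := EulerProduct.eulerProduct_hasProd (f := F) (by simp [hF, fP_one]) (by
    intro m n hmn
    simp only [hF, fP_mul P hmn,
      ArithmeticFunction.isMultiplicative_moebius.map_mul_of_coprime hmn]
    push_cast
    rw [mul_pow, div_mul_div_comm]
    ring) hs (by simp [hF])
  have h2 : ∀ p : Nat.Primes, ∑' e, F ((p : ℕ) ^ e) = 1 - (fP P (p : ℕ) : ℝ) / ((p : ℕ) : ℝ) ^ 2 := by
    intro p
    rw [tsum_eq_sum (s := Finset.range 2)]
    · rw [Finset.sum_range_succ, Finset.sum_range_one]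
      simp [hF, fP_one, ArithmeticFunction.moebius_apply_prime p.2]
      ring
    · intro e he
      have : 2 ≤ e := by
        rw [Finset.mem_range] at he
        omega
      have h3 : ArithmeticFunction.moebius ((p : ℕ) ^ e) = 0 := by
        rw [ArithmeticFunction.moebius_apply_prime_pow p.2 (by omega), if_neg (by omega)]
      simp only [hF, h3]; simp
  have h4 : betaP P = ∑' d, F d := by
    unfold betaP
    rw [← hp.tprod_eq]
    exact tprod_congr (fun p => (h2 p).symm)
  rw [h4]
  exact hs.of_norm.hasSum

/-- **Proposition.** `#F_{Q,P} = (Q²/2) ∏_p (1 − f_P(p)/p²) + O(Q^{1+ε})`. -/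
theorem card_polyFarey (ν : ℕ) (hν : 1 ≤ ν) (c : ℕ → ℤ) (hcν : c ν ≠ 0)
    (P : Polynomial ℤ)
    (hP : P = ∑ i ∈ Finset.Icc 1 ν, Polynomial.C (c i) * Polynomial.X ^ i)
    (hdisc : (P.map (Int.castRingHom ℚ)).Separable) :
    ∀ ε : ℝ, 0 < ε → ∃ C : ℝ, 0 < C ∧ ∀ Q : ℕ, 1 ≤ Q →
      |((fareyPairs P Q).card : ℝ) - (Q : ℝ) ^ 2 / 2 * betaP P| ≤
        C * (Q : ℝ) ^ ((1 : ℝ) + ε) := by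
  intro ε hε
  have hP0 : P ≠ 0 := by
    rintro h0
    rw [h0, Polynomial.map_zero] at hdisc
    exact Polynomial.not_separable_zero hdisc
  obtain ⟨δ, hδ, hδ1, hδε⟩ : ∃ δ : ℝ, 0 < δ ∧ 2 * δ ≤ 1 ∧ 2 * δ ≤ ε :=
    ⟨min ε 1 / 2, by positivity, by linarith [min_le_right ε 1], by linarith [min_le_left ε 1]⟩
  obtain ⟨C, hC, hg⟩ := g_bound P hP0 δ hδ
  have hsum : Summable (fun d : ℕ => (d : ℝ) ^ (-(1 + δ))) :=
    Real.summable_nat_rpow.2 (by linarith)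
  set S : ℝ := ∑' d : ℕ, (d : ℝ) ^ (-(1 + δ)) with hS
  have hS0 : 0 ≤ S := tsum_nonneg (fun d => by positivity)
  refine ⟨C * (S + 1), by positivity, fun Q hQ => ?_⟩
  have hQ' : (1 : ℝ) ≤ Q := by exact_mod_cast hQ
  set g : ℕ → ℝ := fun d => (ArithmeticFunction.moebius d : ℝ) * fP P d with hgdef
  have hA : HasSum (fun d : ℕ => g d * (((Q / d : ℕ) : ℝ) * (((Q / d : ℕ) : ℝ) + 1) / 2))
      ((fareyPairs P Q).card : ℝ) := by
    rw [card_fareyPairs]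
    apply hasSum_sum_of_ne_finset_zero
    intro d hd
    rcases Nat.eq_zero_or_pos d with rfl | hd0
    · simp
    · have : Q < d := by
        simp only [Finset.mem_Icc] at hd; omega
      rw [Nat.div_eq_of_lt this]; simp
  have hB := (betaP_hasSum P hP0).mul_left ((Q : ℝ) ^ 2 / 2)
  have hAB := hA.sub hB
  have hR : HasSum (fun d : ℕ => C * (Q : ℝ) ^ (1 + 2 * δ) * (d : ℝ) ^ (-(1 + δ)))
      (C * (Q : ℝ) ^ (1 + 2 * δ) * S) := hsum.hasSum.mul_left _
  have hle : |((fareyPairs P Q).card : ℝ) - (Q : ℝ) ^ 2 / 2 * betaP P| ≤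
      C * (Q : ℝ) ^ (1 + 2 * δ) * S := by
    rw [← Real.norm_eq_abs, ← hAB.tsum_eq]
    refine tsum_of_norm_bounded hR (fun d => ?_)
    rcases Nat.eq_zero_or_pos d with rfl | hd
    · simp; positivity
    have hd' : (0 : ℝ) < d := by exact_mod_cast hd
    have h1 : g d * (((Q / d : ℕ) : ℝ) * (((Q / d : ℕ) : ℝ) + 1) / 2) -
        (Q : ℝ) ^ 2 / 2 * (g d / (d : ℝ) ^ 2) =
        g d * (((Q / d : ℕ) : ℝ) * (((Q / d : ℕ) : ℝ) + 1) / 2 - ((Q : ℝ) / d) ^ 2 / 2) := by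
      rw [div_pow]; ring
    have h2 := T_bound Q d hQ hd (2 * δ) (by positivity) hδ1
    have h3 : C * (Q : ℝ) ^ (1 + 2 * δ) * (d : ℝ) ^ (-(1 + δ)) =
        C * (d : ℝ) ^ δ * ((Q : ℝ) / d) ^ (1 + 2 * δ) := by
      rw [Real.div_rpow (by positivity) (by positivity), div_eq_mul_inv, ← Real.rpow_neg hd'.le]
      have : -(1 + δ) = δ + -(1 + 2 * δ) := by ring
      rw [this, Real.rpow_add hd']; ring
    change ‖g d * (((Q / d : ℕ) : ℝ) * (((Q / d : ℕ) : ℝ) + 1) / 2) -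
        (Q : ℝ) ^ 2 / 2 * (g d / (d : ℝ) ^ 2)‖ ≤ _
    rw [h1, h3, Real.norm_eq_abs, abs_mul]
    exact mul_le_mul (hg d) h2 (abs_nonneg _) (by positivity)
  have h5 : (Q : ℝ) ^ (1 + 2 * δ) ≤ (Q : ℝ) ^ (1 + ε) :=
    Real.rpow_le_rpow_of_exponent_le hQ' (by linarith)
  calc _ ≤ C * (Q : ℝ) ^ (1 + 2 * δ) * S := hle
    _ ≤ C * (Q : ℝ) ^ (1 + ε) * (S + 1) := by gcongr; linarith
    _ = _ := by ring
end
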